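/- (Right-handed Cullen lemma.) Let Ω ⊆ H be an open set disjoint from the real axis and let f = u + ιv be a complex-like, ℝ-differentiable function on Ω. Then f is right-hyperholomorphic on Ω (i.e., (D_r f)(p) = −2v(p)/r(p) for all p ∈ Ω) if and only if for all p ∈ Ω: D_r(q ↦ f(q)/r(q)²)(p) = −(2/r(p)³)·u(p)·ι(p). -/

import Mathlib

open Quaternion MeasureTheory

noncomputable section

/-- `r(p)` : distance from the real axis. -/
def rr (p : ℍ[ℝ]) : ℝ := Real.sqrt (p.imI ^ 2 + p.imJ ^ 2 + p.imK ^ 2)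

def qi : ℍ[ℝ] := ⟨0, 1, 0, 0⟩
def qj : ℍ[ℝ] := ⟨0, 0, 1, 0⟩
def qk : ℍ[ℝ] := ⟨0, 0, 0, 1⟩

/-- imaginary part of a quaternion -/
def qim (p : ℍ[ℝ]) : ℍ[ℝ] := ⟨0, p.imI, p.imJ, p.imK⟩

/-- `ι(p)` -/
def iota (p : ℍ[ℝ]) : ℍ[ℝ] := (rr p)⁻¹ • qim p

/-- left Fueter operator -/
def Dl (f : ℍ[ℝ] → ℍ[ℝ]) (p : ℍ[ℝ]) : ℍ[ℝ] :=
  fderiv ℝ f p 1 + qi * fderiv ℝ f p qi + qj * fderiv ℝ f p qj + qk * fderiv ℝ f p qk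

/-- right Fueter operator -/
def Dr (f : ℍ[ℝ] → ℍ[ℝ]) (p : ℍ[ℝ]) : ℍ[ℝ] :=
  fderiv ℝ f p 1 + fderiv ℝ f p qi * qi + fderiv ℝ f p qj * qj + fderiv ℝ f p qk * qk

/-- hyperholomorphic on `Ω` with decomposition `f = u + ι v` -/
def Hyperholo (Ω : Set ℍ[ℝ]) (f : ℍ[ℝ] → ℍ[ℝ]) (u v : ℍ[ℝ] → ℝ) : Prop :=
  (∀ p ∈ Ω, DifferentiableAt ℝ f p) ∧
  (∀ p ∈ Ω, f p = (u p : ℍ[ℝ]) + iota p * (v p : ℍ[ℝ])) ∧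
  (∀ p ∈ Ω, Dl f p = ((-2 * v p / rr p : ℝ) : ℍ[ℝ]))

/-- spherical parametrization of the imaginary unit sphere -/
def iotaSph (α β : ℝ) : ℍ[ℝ] :=
  ⟨0, Real.cos α * Real.sin β, Real.sin α * Real.sin β, Real.cos β⟩

/-- the point `t + r·ι(α,β)` -/
def pt (t r α β : ℝ) : ℍ[ℝ] := (t : ℍ[ℝ]) + (r : ℍ[ℝ]) * iotaSph α β


@[simp] lemma re_qi : qi.re = 0 := rfl
@[simp] lemma imI_qi : qi.imI = 1 := rfl
@[simp] lemma imJ_qi : qi.imJ = 0 := rfl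
@[simp] lemma imK_qi : qi.imK = 0 := rfl
@[simp] lemma re_qj : qj.re = 0 := rfl
@[simp] lemma imI_qj : qj.imI = 0 := rfl
@[simp] lemma imJ_qj : qj.imJ = 1 := rfl
@[simp] lemma imK_qj : qj.imK = 0 := rfl
@[simp] lemma re_qk : qk.re = 0 := rfl
@[simp] lemma imI_qk : qk.imI = 0 := rfl
@[simp] lemma imJ_qk : qk.imJ = 0 := rfl
@[simp] lemma imK_qk : qk.imK = 1 := rfl

@[simp] lemma re_qim (p : ℍ[ℝ]) : (qim p).re = 0 := rfl
@[simp] lemma imI_qim (p : ℍ[ℝ]) : (qim p).imI = p.imI := rfl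
@[simp] lemma imJ_qim (p : ℍ[ℝ]) : (qim p).imJ = p.imJ := rfl
@[simp] lemma imK_qim (p : ℍ[ℝ]) : (qim p).imK = p.imK := rfl

/-- The squared distance from the real axis, as a polynomial in the coordinates. -/
lemma rr_sq (p : ℍ[ℝ]) : rr p ^ 2 = p.imI ^ 2 + p.imJ ^ 2 + p.imK ^ 2 :=
  Real.sq_sqrt (by positivity)

lemma rr_ne_zero {p : ℍ[ℝ]} (hp : qim p ≠ 0) : rr p ≠ 0 := by
  intro h
  have hsq := rr_sq p
  rw [h] at hsq
  apply hp
  ext <;> simp only [re_qim, imI_qim, imJ_qim, imK_qim, re_zero, imI_zero, imJ_zero, imK_zero] <;>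
    nlinarith [sq_nonneg p.imI, sq_nonneg p.imJ, sq_nonneg p.imK]

lemma hasFDerivAt_rr_sq (p : ℍ[ℝ]) :
    ∃ L : ℍ[ℝ] →L[ℝ] ℝ, HasFDerivAt (fun q => rr q ^ 2) L p ∧
      ∀ h, L h = 2 * (p.imI * h.imI + p.imJ * h.imJ + p.imK * h.imK) := by
  let I : ℍ[ℝ] →L[ℝ] ℝ :=
    LinearMap.toContinuousLinearMap (E := ℍ[ℝ]) (QuaternionAlgebra.imIₗ (-1 : ℝ) 0 (-1))
  let J : ℍ[ℝ] →L[ℝ] ℝ :=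
    LinearMap.toContinuousLinearMap (E := ℍ[ℝ]) (QuaternionAlgebra.imJₗ (-1 : ℝ) 0 (-1))
  let K : ℍ[ℝ] →L[ℝ] ℝ :=
    LinearMap.toContinuousLinearMap (E := ℍ[ℝ]) (QuaternionAlgebra.imKₗ (-1 : ℝ) 0 (-1))
  have hd := ((I.hasFDerivAt (x := p)).pow 2).add ((J.hasFDerivAt (x := p)).pow 2) |>.add
    ((K.hasFDerivAt (x := p)).pow 2)
  refine ⟨_, hd.congr_of_eventuallyEq (Filter.Eventually.of_forall fun q => rr_sq q), fun h => ?_⟩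
  have hI (q : ℍ[ℝ]) : I q = q.imI := rfl
  have hJ (q : ℍ[ℝ]) : J q = q.imJ := rfl
  have hK (q : ℍ[ℝ]) : K q = q.imK := rfl
  simp [hI, hJ, hK]
  ring

/-- The right Fueter operator applied to `f / r²`. -/
lemma Dr_div_rr_sq {f : ℍ[ℝ] → ℍ[ℝ]} {p : ℍ[ℝ]} (hp : qim p ≠ 0)
    (hf : DifferentiableAt ℝ f p) :
    Dr (fun q => f q / ((rr q ^ 2 : ℝ) : ℍ[ℝ])) p =
      (rr p ^ 2)⁻¹ • Dr f p - (2 / rr p ^ 3) • (f p * iota p) := by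
  have hr := rr_ne_zero hp
  obtain ⟨L, hL, hLh⟩ := hasFDerivAt_rr_sq p
  have hfun : (fun q => f q / ((rr q ^ 2 : ℝ) : ℍ[ℝ])) = fun q => (rr q ^ 2)⁻¹ • f q := by
    funext q
    rw [div_eq_mul_inv, ← Quaternion.coe_inv, Quaternion.mul_coe_eq_smul]
  have hinv := (hasDerivAt_inv (pow_ne_zero 2 hr)).comp_hasFDerivAt p hL
  have hd : fderiv ℝ (fun q => (rr q ^ 2)⁻¹ • f q) p = _ := (hinv.smul hf.hasFDerivAt).fderiv
  have hpim : f p * iota p =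
      (rr p)⁻¹ • (p.imI • (f p * qi) + p.imJ • (f p * qj) + p.imK • (f p * qk)) := by
    have : qim p = p.imI • qi + p.imJ • qj + p.imK • qk := by
      ext <;> simp
    simp only [iota, this, mul_smul_comm, mul_add]
  rw [hfun, hpim]
  simp only [Dr, hd, add_apply, smul_apply,
    ContinuousLinearMap.smulRight_apply, hLh, Function.comp_apply, smul_eq_mul, add_mul,
    smul_mul_assoc]
  simp only [imI_qi, imJ_qi, imK_qi, imI_qj, imJ_qj, imK_qj, imI_qk, imJ_qk, imK_qk,
    imI_one, imJ_one, imK_one]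
  match_scalars <;> field_simp <;> ring

lemma iota_mul_self {p : ℍ[ℝ]} (hp : qim p ≠ 0) : iota p * iota p = -1 := by
  have hr := rr_ne_zero hp
  have hq : qim p * qim p = -((rr p ^ 2 : ℝ) : ℍ[ℝ]) := by
    rw [rr_sq]
    rw [← Quaternion.coe_neg]
    ext <;> simp only [re_mul, imI_mul, imJ_mul, imK_mul, re_qim, imI_qim, imJ_qim, imK_qim,
      re_coe, imI_coe, imJ_coe, imK_coe] <;> ring
  rw [iota, smul_mul_smul_comm, hq, smul_neg, Quaternion.smul_coe]
  field_simp
  simp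

/-- Right-handed Cullen lemma: a complex-like, ℝ-differentiable function is
right-hyperholomorphic iff `D_r(f/r²) = -(2/r³)·u·ι`. -/
theorem cullen_lemma_right (Ω : Set ℍ[ℝ]) (hΩ : IsOpen Ω)
    (hax : ∀ p ∈ Ω, qim p ≠ 0)
    (f : ℍ[ℝ] → ℍ[ℝ]) (u v : ℍ[ℝ] → ℝ)
    (hcl : ∀ p ∈ Ω, f p = (u p : ℍ[ℝ]) + iota p * (v p : ℍ[ℝ]))
    (hdiff : ∀ p ∈ Ω, DifferentiableAt ℝ f p) :
    (∀ p ∈ Ω, Dr f p = ((-2 * v p / rr p : ℝ) : ℍ[ℝ])) ↔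
      (∀ p ∈ Ω, Dr (fun q => f q / ((rr q ^ 2 : ℝ) : ℍ[ℝ])) p
          = -((2 / rr p ^ 3 : ℝ) : ℍ[ℝ]) * (u p : ℍ[ℝ]) * iota p) := by
  have key : ∀ p ∈ Ω, (Dr f p = ((-2 * v p / rr p : ℝ) : ℍ[ℝ]) ↔
      Dr (fun q => f q / ((rr q ^ 2 : ℝ) : ℍ[ℝ])) p
        = -((2 / rr p ^ 3 : ℝ) : ℍ[ℝ]) * (u p : ℍ[ℝ]) * iota p) := by
    intro p hp
    have hr := rr_ne_zero (hax p hp)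
    have hfi : f p * iota p = u p • iota p - ((v p : ℝ) : ℍ[ℝ]) := by
      rw [hcl p hp, add_mul, Quaternion.coe_mul_eq_smul, Quaternion.mul_coe_eq_smul (v p),
        smul_mul_assoc, iota_mul_self (hax p hp), smul_neg, ← Quaternion.coe_mul_eq_smul (v p),
        mul_one, sub_eq_add_neg]
    have hdiv : Dr (fun q => f q / ((rr q ^ 2 : ℝ) : ℍ[ℝ])) p =
        (rr p ^ 2)⁻¹ • (Dr f p - ((-2 * v p / rr p : ℝ) : ℍ[ℝ])) +
          -((2 / rr p ^ 3 : ℝ) : ℍ[ℝ]) * (u p : ℍ[ℝ]) * iota p := by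
      rw [Dr_div_rr_sq (hax p hp) (hdiff p hp), hfi, neg_mul (Quaternion.coe _), neg_mul (_ * _), mul_assoc (Quaternion.coe _),
        Quaternion.coe_mul_eq_smul, Quaternion.coe_mul_eq_smul, smul_sub, smul_sub,
        Quaternion.smul_coe, Quaternion.smul_coe,
        show (rr p ^ 2)⁻¹ * (-2 * v p / rr p) = -(2 / rr p ^ 3 * v p) by field_simp,
        Quaternion.coe_neg]
      abel
    rw [hdiv, add_eq_right, smul_eq_zero_iff_right (inv_ne_zero (pow_ne_zero 2 hr)), sub_eq_zero]
  exact forall₂_congr key
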